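/- Let p be prime and P ∈ ℤ[x₁,...,xₙ] p-primitive. The number N_e of solutions of P(x) ≡ 0 (mod p^e) in (ℤ/p^eℤ)^n equals the sum of p^{n(e-k)} over all trunk vertices (r,k) satisfying φ(r,k) - t_k < e ≤ φ(r,k). -/

import Mathlib

open MvPolynomial

/-- `pShift p m r P` is the polynomial `P(r + pᵐ·x)`. -/
noncomputable def pShift (p : ℕ) [Fact p.Prime] {n : ℕ} (m : ℕ) (r : Fin n → ℤ_[p])
    (P : MvPolynomial (Fin n) ℤ_[p]) : MvPolynomial (Fin n) ℤ_[p] :=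
  bind₁ (fun i => C (r i) + C ((p : ℤ_[p]) ^ m) * X i) P

/-- `Trunk p P₀ r k φ t Pk` means `(r, k)` is a vertex of the trunk of `P₀`, with tree-top
value `φ` (the sum of the thicknesses along the path to the root), thickness `t` at this
vertex (`0` at the root by convention), and attached polynomial `Pk`. -/
inductive Trunk (p : ℕ) [Fact p.Prime] {n : ℕ} (P₀ : MvPolynomial (Fin n) ℤ_[p]) :
    (Fin n → ℤ_[p]) → ℕ → ℕ → ℕ → MvPolynomial (Fin n) ℤ_[p] → Prop
  | root : Trunk p P₀ 0 0 0 0 P₀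
  | step {r : Fin n → ℤ_[p]} {k φ t : ℕ} {Pk : MvPolynomial (Fin n) ℤ_[p]}
      (rk : Fin n → ℤ_[p]) (t' : ℕ) (Q : MvPolynomial (Fin n) ℤ_[p]) :
      Trunk p P₀ r k φ t Pk →
      (p : ℤ_[p]) ∣ eval rk Pk →
      pShift p 1 rk Pk = C ((p : ℤ_[p]) ^ t') * Q →
      ¬ C (p : ℤ_[p]) ∣ Q →
      Trunk p P₀ (r + (p : ℤ_[p]) ^ k • rk) (k + 1) (φ + t') t' Q

section Shift

variable {p : ℕ} [Fact p.Prime] {n : ℕ}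

theorem pShift_C_mul (m : ℕ) (r : Fin n → ℤ_[p]) (a : ℤ_[p]) (Q : MvPolynomial (Fin n) ℤ_[p]) :
    pShift p m r (C a * Q) = C a * pShift p m r Q := by
  simp [pShift]

theorem pShift_pShift (k m : ℕ) (r s : Fin n → ℤ_[p]) (P : MvPolynomial (Fin n) ℤ_[p]) :
    pShift p m s (pShift p k r P) = pShift p (k + m) (r + (p : ℤ_[p]) ^ k • s) P := by
  unfold pShift
  rw [bind₁_bind₁]
  congr 2
  funext i
  simp only [map_add, map_mul, bind₁_C_right, bind₁_X_right, Pi.add_apply, Pi.smul_apply,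
    smul_eq_mul, pow_add]
  ring

theorem pShift_zero_zero (P : MvPolynomial (Fin n) ℤ_[p]) : pShift p 0 0 P = P := by
  simp [pShift, bind₁_X_left]

theorem eval_pShift (m : ℕ) (r y : Fin n → ℤ_[p]) (P : MvPolynomial (Fin n) ℤ_[p]) :
    eval y (pShift p m r P) = eval (r + (p : ℤ_[p]) ^ m • y) P := by
  unfold pShift
  rw [← coe_aeval_eq_eval, ← coe_aeval_eq_eval]
  simp only [RingHom.coe_coe, aeval_bind₁]
  congr 2
  funext i
  simp

theorem pShift_ne_zero (m : ℕ) (r : Fin n → ℤ_[p]) {P : MvPolynomial (Fin n) ℤ_[p]}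
    (hP : P ≠ 0) : pShift p m r P ≠ 0 := by
  intro h
  apply hP
  apply map_injective (algebraMap ℤ_[p] ℚ_[p]) (IsFractionRing.injective ℤ_[p] ℚ_[p])
  rw [map_zero]
  apply MvPolynomial.funext
  intro z
  have hp : (p : ℚ_[p]) ≠ 0 := by exact_mod_cast (Fact.out : p.Prime).ne_zero
  have h2 := congrArg
    (aeval (fun i => (z i - algebraMap ℤ_[p] ℚ_[p] (r i)) / (p : ℚ_[p]) ^ m)) h
  rw [pShift, aeval_bind₁, map_zero] at h2
  rw [eval_map, map_zero, ← h2, aeval_def]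
  congr 1
  funext i
  simp only [map_add, map_mul, aeval_C, aeval_X, map_pow, map_natCast]
  field_simp
  ring

/-- The polynomial `P(r + pᵏ·x)` is divisible by `pᵉ`. -/
def ShiftDvd (P : MvPolynomial (Fin n) ℤ_[p]) (e : ℕ) (r : Fin n → ℤ_[p]) (k : ℕ) : Prop :=
  C ((p : ℤ_[p]) ^ e) ∣ pShift p k r P

variable {P : MvPolynomial (Fin n) ℤ_[p]} {e k : ℕ} {r : Fin n → ℤ_[p]}

theorem ShiftDvd.add (h : ShiftDvd P e r k) (m : ℕ) (s : Fin n → ℤ_[p]) :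
    ShiftDvd P e (r + (p : ℤ_[p]) ^ k • s) (k + m) := by
  obtain ⟨Q, hQ⟩ := h
  exact ⟨pShift p m s Q, by rw [← pShift_pShift, hQ, pShift_C_mul]⟩

theorem shiftDvd_add_iff (s : Fin n → ℤ_[p]) :
    ShiftDvd P e (r + (p : ℤ_[p]) ^ k • s) k ↔ ShiftDvd P e r k := by
  constructor
  · intro h
    simpa using h.add 0 (-s)
  · intro h
    exact h.add 0 s

theorem ShiftDvd.succ (h : ShiftDvd P e r k) : ShiftDvd P e r (k + 1) := by
  simpa using h.add 1 0

theorem ShiftDvd.dvd_eval (h : ShiftDvd P e r k) : (p : ℤ_[p]) ^ e ∣ eval r P := by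
  obtain ⟨Q, hQ⟩ := h
  have := congrArg (eval 0) hQ
  rw [eval_pShift] at this
  simp only [smul_zero, add_zero, map_mul, eval_C] at this
  exact ⟨_, this⟩

/-- Modulo `a`, the polynomial `P(r + a·x)` is the constant `P(r)`. -/
theorem C_dvd_bind₁_sub (a : ℤ_[p]) (P : MvPolynomial (Fin n) ℤ_[p]) (r : Fin n → ℤ_[p]) :
    C a ∣ bind₁ (fun i => C (r i) + C a * X i) P - C (eval r P) := by
  induction P using MvPolynomial.induction_on with
  | C b => simp
  | add f g hf hg =>
    simp only [map_add]
    rw [add_sub_add_comm]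
    exact dvd_add hf hg
  | mul_X f i hf =>
    obtain ⟨u, hu⟩ := hf
    simp only [map_mul, bind₁_X_right, eval_X]
    rw [sub_eq_iff_eq_add] at hu
    rw [hu]
    exact ⟨u * C (r i) + C a * u * X i + C (eval r f) * X i, by ring⟩

theorem shiftDvd_self_iff : ShiftDvd P e r e ↔ (p : ℤ_[p]) ^ e ∣ eval r P := by
  refine ⟨ShiftDvd.dvd_eval, fun h => ?_⟩
  have := C_dvd_bind₁_sub ((p : ℤ_[p]) ^ e) P r
  exact (dvd_iff_dvd_of_dvd_sub this).2 (map_dvd C h)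

theorem shiftDvd_iff_le {φ : ℕ} {Q : MvPolynomial (Fin n) ℤ_[p]}
    (h : pShift p k r P = C ((p : ℤ_[p]) ^ φ) * Q) (hQ : ¬ C (p : ℤ_[p]) ∣ Q) :
    ShiftDvd P e r k ↔ e ≤ φ := by
  have hp : (C ((p : ℤ_[p]) ^ φ) : MvPolynomial (Fin n) ℤ_[p]) ≠ 0 := by
    rw [Ne, C_eq_zero]
    exact pow_ne_zero _ (by exact_mod_cast (Fact.out : p.Prime).ne_zero)
  unfold ShiftDvd
  rw [h]
  constructor
  · intro hd
    by_contra! hlt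
    obtain ⟨d, rfl⟩ := Nat.exists_eq_add_of_lt hlt
    rw [show φ + d + 1 = φ + (1 + d) by ring, pow_add, C_mul, mul_dvd_mul_iff_left hp, pow_add,
      pow_one, C_mul] at hd
    exact hQ (dvd_of_mul_right_dvd hd)
  · intro hle
    exact Dvd.dvd.mul_right (map_dvd C (pow_dvd_pow _ hle)) _

theorem Trunk.pShift_eq {P₀ Pk : MvPolynomial (Fin n) ℤ_[p]} (hprim : ¬ C (p : ℤ_[p]) ∣ P₀)
    {φ t : ℕ} (h : Trunk p P₀ r k φ t Pk) :
    pShift p k r P₀ = C ((p : ℤ_[p]) ^ φ) * Pk ∧ ¬ C (p : ℤ_[p]) ∣ Pk := by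
  induction h with
  | root => simpa [pShift_zero_zero] using hprim
  | step rk t' Q _ _ hs hQ ih =>
    refine ⟨?_, hQ⟩
    rw [← pShift_pShift, ih.1, pShift_C_mul, hs, pow_add, C_mul, mul_assoc]

theorem exists_eq_C_pow_mul {Q : MvPolynomial (Fin n) ℤ_[p]} (hQ : Q ≠ 0) :
    ∃ (t : ℕ) (Q' : MvPolynomial (Fin n) ℤ_[p]),
      Q = C ((p : ℤ_[p]) ^ t) * Q' ∧ ¬ C (p : ℤ_[p]) ∣ Q' := by
  have hu : ¬ IsUnit (C (p : ℤ_[p]) : MvPolynomial (Fin n) ℤ_[p]) := fun h =>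
    PadicInt.prime_p.not_isUnit (by simpa using h.map constantCoeff)
  obtain ⟨Q', h1, h2⟩ := (FiniteMultiplicity.of_not_isUnit hu hQ).exists_eq_pow_mul_and_not_dvd
  exact ⟨_, Q', by rw [C_pow]; exact h1, h2⟩

theorem Trunk.exists_step {P₀ Pk : MvPolynomial (Fin n) ℤ_[p]} (hprim : ¬ C (p : ℤ_[p]) ∣ P₀)
    {φ t : ℕ} (h : Trunk p P₀ r k φ t Pk) (s : Fin n → ℤ_[p])
    (he : (p : ℤ_[p]) ^ e ∣ eval (r + (p : ℤ_[p]) ^ k • s) P₀) (hlt : φ < e) :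
    ∃ t' Q, Trunk p P₀ (r + (p : ℤ_[p]) ^ k • s) (k + 1) (φ + t') t' Q := by
  obtain ⟨h1, h2⟩ := h.pShift_eq hprim
  have hPk : Pk ≠ 0 := by
    rintro rfl
    exact h2 (dvd_zero _)
  obtain ⟨t', Q, hQ, hQ'⟩ := exists_eq_C_pow_mul (pShift_ne_zero 1 s hPk)
  refine ⟨t', Q, h.step s t' Q ?_ hQ hQ'⟩
  have hp : (p : ℤ_[p]) ^ φ ≠ 0 :=
    pow_ne_zero _ (by exact_mod_cast (Fact.out : p.Prime).ne_zero)
  rw [← eval_pShift, h1, map_mul, eval_C] at he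
  have := (pow_dvd_pow (p : ℤ_[p]) (Nat.succ_le_of_lt hlt)).trans he
  rwa [pow_succ, mul_dvd_mul_iff_left hp] at this

theorem Trunk.lt_of_not_shiftDvd {P₀ Pk : MvPolynomial (Fin n) ℤ_[p]}
    (hprim : ¬ C (p : ℤ_[p]) ∣ P₀) {φ t : ℕ} (h : Trunk p P₀ r k φ t Pk) {s : Fin n → ℤ_[p]}
    (hk : ¬ ShiftDvd P₀ e (r + (p : ℤ_[p]) ^ k • s) k) : φ < e := by
  obtain ⟨h1, h2⟩ := h.pShift_eq hprim
  rwa [shiftDvd_add_iff, shiftDvd_iff_le h1 h2, not_le] at hk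

theorem exists_trunk_of_not_shiftDvd (hprim : ¬ C (p : ℤ_[p]) ∣ P)
    (hr : (p : ℤ_[p]) ^ e ∣ eval r P) (hk : ¬ ShiftDvd P e r k) :
    ∃ r' s φ t Q, Trunk p P r' k φ t Q ∧ r = r' + (p : ℤ_[p]) ^ k • s := by
  induction k with
  | zero => exact ⟨0, r, 0, 0, P, .root, by simp⟩
  | succ k ih =>
    have hk' : ¬ ShiftDvd P e r k := fun h => hk h.succ
    obtain ⟨r', s, φ, t, Q, hT, rfl⟩ := ih hk'
    obtain ⟨t', Q', hT'⟩ := hT.exists_step hprim s hr (hT.lt_of_not_shiftDvd hprim hk')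
    exact ⟨_, 0, _, _, _, hT', by simp⟩

/-- A trunk vertex `(r, k)` carries level `e` exactly when `k` is the first level at which
`pᵉ` divides the content of the shifted polynomial. -/
theorem exists_trunk_iff (hprim : ¬ C (p : ℤ_[p]) ∣ P) :
    (∃ φ t Pk, Trunk p P r (k + 1) φ t Pk ∧ φ - t < e ∧ e ≤ φ) ↔
      ShiftDvd P e r (k + 1) ∧ ¬ ShiftDvd P e r k := by
  constructor
  · rintro ⟨φ, t, Pk, hT, hlt, hle⟩
    obtain ⟨h1, h2⟩ := hT.pShift_eq hprim
    refine ⟨(shiftDvd_iff_le h1 h2).2 hle, ?_⟩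
    cases hT with
    | step rk t' Q hT' _ _ _ =>
      obtain ⟨h3, h4⟩ := hT'.pShift_eq hprim
      rw [shiftDvd_add_iff, shiftDvd_iff_le h3 h4]
      omega
  · rintro ⟨h, hn⟩
    obtain ⟨r', s, φ, t, Q, hT, rfl⟩ := exists_trunk_of_not_shiftDvd hprim h.dvd_eval hn
    have hlt := hT.lt_of_not_shiftDvd hprim hn
    obtain ⟨t', Q', hT'⟩ := hT.exists_step hprim s h.dvd_eval hlt
    obtain ⟨h1, h2⟩ := hT'.pShift_eq hprim
    exact ⟨_, _, _, hT', by omega, (shiftDvd_iff_le h1 h2).1 h⟩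

theorem not_exists_trunk_zero (he : 1 ≤ e) :
    ¬ ∃ φ t Pk, Trunk p P r 0 φ t Pk ∧ φ - t < e ∧ e ≤ φ := by
  rintro ⟨φ, t, Pk, hT, -, hle⟩
  cases hT
  omega

theorem not_shiftDvd_zero (hprim : ¬ C (p : ℤ_[p]) ∣ P) (he : 1 ≤ e) :
    ¬ ShiftDvd P e r 0 := by
  have h : pShift p 0 0 P = C ((p : ℤ_[p]) ^ 0) * P := by simp [pShift_zero_zero]
  have := shiftDvd_add_iff (P := P) (e := e) (k := 0) (r := 0) r
  rw [shiftDvd_iff_le h hprim] at this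
  simp only [pow_zero, one_smul, zero_add] at this
  rw [this]
  omega

theorem not_C_dvd_map {P : MvPolynomial (Fin n) ℤ} (hprim : ¬ C (p : ℤ) ∣ P) :
    ¬ C (p : ℤ_[p]) ∣ MvPolynomial.map (Int.castRingHom ℤ_[p]) P := by
  rw [C_dvd_iff_dvd_coeff] at hprim ⊢
  contrapose! hprim
  intro i
  have := hprim i
  rw [coeff_map, eq_intCast] at this
  rwa [← PadicInt.norm_lt_one_iff_dvd, PadicInt.norm_int_lt_one_iff_dvd] at this

theorem shiftDvd_mod_iff {j : ℕ} (hj : j ≤ k) (x : Fin n → ℕ) :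
    ShiftDvd P e (fun i => ((x i % p ^ k : ℕ) : ℤ_[p])) j ↔
      ShiftDvd P e (fun i => (x i : ℤ_[p])) j := by
  obtain ⟨d, rfl⟩ := Nat.exists_eq_add_of_le hj
  rw [← shiftDvd_add_iff (r := fun i => ((x i % p ^ (j + d) : ℕ) : ℤ_[p]))
    (fun i => (p : ℤ_[p]) ^ d * ((x i / p ^ (j + d) : ℕ) : ℤ_[p]))]
  congr! 1
  funext i
  simp only [Pi.add_apply, Pi.smul_apply, smul_eq_mul, ← mul_assoc, ← pow_add]
  exact_mod_cast Nat.mod_add_div _ _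

theorem eval_map_natCast_eq_zero_iff (P : MvPolynomial (Fin n) ℤ) (x : Fin n → ℕ) :
    eval (fun i => (x i : ZMod (p ^ e))) (MvPolynomial.map (Int.castRingHom (ZMod (p ^ e))) P) = 0
      ↔ ShiftDvd (MvPolynomial.map (Int.castRingHom ℤ_[p]) P) e (fun i => (x i : ℤ_[p])) e := by
  rw [shiftDvd_self_iff, ← Ideal.mem_span_singleton, ← PadicInt.ker_toZModPow, RingHom.mem_ker,
    eval_map, eval_map, hom_eval₂]
  congr! 2
  · exact RingHom.ext_int _ _
  · funext i
    simp

end Shift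

/-- Each residue vector modulo `b` has `aⁿ` lifts modulo `a * b`. -/
theorem sum_mod_eq {n N a b : ℕ} (h : N = a * b) (f : (Fin n → ℕ) → ℕ) :
    ∑ x : Fin n → Fin N, f (fun i => x i % b) =
      ∑ r : Fin n → Fin b, f (fun i => r i) * a ^ n := by
  subst h
  let E : (Fin n → Fin a) × (Fin n → Fin b) ≃ (Fin n → Fin (a * b)) :=
    (Equiv.arrowProdEquivProdArrow _ _ _).symm.trans (Equiv.arrowCongr (.refl _) finProdFinEquiv)
  rw [← E.sum_comp, Fintype.sum_prod_type_right]
  refine Finset.sum_congr rfl fun r _ => ?_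
  have : ∀ q, (fun i => (E (q, r) i : ℕ) % b) = fun i => (r i : ℕ) := by
    intro q
    funext i
    simp [E, Equiv.arrowProdEquivProdArrow, Nat.mod_eq_of_lt]
  simp [this, mul_comm]

theorem ZMod.bijective_natCast_fin (N : ℕ) [NeZero N] :
    Function.Bijective fun i : Fin N => ((i : ℕ) : ZMod N) := by
  refine ⟨fun i j h => ?_, fun z => ⟨⟨z.val, z.val_lt⟩, ZMod.natCast_zmod_val z⟩⟩
  have := congrArg ZMod.val h
  simpa [Nat.mod_eq_of_lt, Fin.ext_iff] using this

open scoped Classical in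
/-- The number of solutions of `P(x) ≡ 0 (mod pᵉ)` in `(ℤ/pᵉℤ)ⁿ` is the sum of
`p^{n(e-k)}` over all trunk vertices `(r,k)` with `φ(r,k) - t_k < e ≤ φ(r,k)`. -/
theorem count_solutions (p : ℕ) [Fact p.Prime] {n : ℕ}
    (P : MvPolynomial (Fin n) ℤ) (hprim : ¬ C (p : ℤ) ∣ P) (e : ℕ) (he : 1 ≤ e) :
    Nat.card {x : Fin n → ZMod (p ^ e) //
        eval x (MvPolynomial.map (Int.castRingHom (ZMod (p ^ e))) P) = 0} =
      ∑ k ∈ Finset.range (e + 1), ∑ r : Fin n → Fin (p ^ k),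
        if ∃ (φ t : ℕ) (Pk : MvPolynomial (Fin n) ℤ_[p]),
            Trunk p (MvPolynomial.map (Int.castRingHom ℤ_[p]) P)
              (fun i => ((r i : ℕ) : ℤ_[p])) k φ t Pk ∧ φ - t < e ∧ e ≤ φ
        then p ^ (n * (e - k)) else 0 := by
  have hprim' := not_C_dvd_map hprim
  set P₀ := MvPolynomial.map (Int.castRingHom ℤ_[p]) P with hP₀
  let g : ℕ → (Fin n → ℕ) → ℕ := fun k x =>
    if ShiftDvd P₀ e (fun i => (x i : ℤ_[p])) k then 1 else 0
  have hlevel : ∀ k ≤ e, ∑ x : Fin n → Fin (p ^ e), g k (fun i => x i) =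
      ∑ j ∈ Finset.range (k + 1), ∑ r : Fin n → Fin (p ^ j),
        if ∃ (φ t : ℕ) (Pk : MvPolynomial (Fin n) ℤ_[p]),
            Trunk p P₀ (fun i => ((r i : ℕ) : ℤ_[p])) j φ t Pk ∧ φ - t < e ∧ e ≤ φ
        then p ^ (n * (e - j)) else 0 := by
    intro k
    induction k with
    | zero =>
      intro _
      simp only [g, not_shiftDvd_zero hprim' he, zero_add, Finset.sum_range_one,
        not_exists_trunk_zero he, if_false, Finset.sum_const_zero]
    | succ k ih =>
      intro hk
      rw [Finset.sum_range_succ, ← ih (by omega)]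
      let f : (Fin n → ℕ) → ℕ := fun x =>
        if ShiftDvd P₀ e (fun i => (x i : ℤ_[p])) (k + 1) ∧
          ¬ ShiftDvd P₀ e (fun i => (x i : ℤ_[p])) k then 1 else 0
      have hpow : p ^ e = p ^ (e - (k + 1)) * p ^ (k + 1) := by
        rw [← pow_add, Nat.sub_add_cancel hk]
      have hsum := sum_mod_eq (n := n) hpow f
      have hf : ∀ x : Fin n → ℕ, f (fun i => x i % p ^ (k + 1)) = f x := by
        intro x
        simp only [f, shiftDvd_mod_iff le_rfl, shiftDvd_mod_iff (Nat.le_succ k)]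
      simp only [hf] at hsum
      simp only [exists_trunk_iff hprim']
      trans ∑ x : Fin n → Fin (p ^ e), (g k (fun i => x i) + f (fun i => x i))
      · refine Finset.sum_congr rfl fun x _ => ?_
        have := ShiftDvd.succ (P := P₀) (e := e) (k := k) (r := fun i => ((x i : ℕ) : ℤ_[p]))
        by_cases hx : ShiftDvd P₀ e (fun i => ((x i : ℕ) : ℤ_[p])) k
        · simp only [g, f, hx, this hx, not_true_eq_false, and_false, if_true, if_false]
        · simp only [g, f, hx, not_false_eq_true, and_true, if_false, zero_add]
      · rw [Finset.sum_add_distrib, hsum]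
        congr 1
        refine Finset.sum_congr rfl fun r _ => ?_
        simp only [f, ite_mul, one_mul, zero_mul, ← pow_mul, mul_comm n]
  rw [← hlevel e le_rfl]
  simp only [g, hP₀, ← eval_map_natCast_eq_zero_iff]
  rw [Finset.sum_boole, Nat.cast_id, ← Fintype.card_subtype, ← Nat.card_eq_fintype_card]
  have : NeZero (p ^ e) := ⟨pow_ne_zero _ (Fact.out : p.Prime).ne_zero⟩
  exact (Nat.card_congr ((Equiv.arrowCongr (.refl _)
    (Equiv.ofBijective _ (ZMod.bijective_natCast_fin (p ^ e)))).subtypeEquiv fun x => Iff.rfl)).symm
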